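/- arXiv:1601.04998 — 11 statements merged into one kernel-verified Lean document; each statement's English description precedes it below -/
import Mathlib

section
/- Let R be a commutative ring and let a, b ∈ R³ represent points of the projective plane over R that are apart from each other (i.e. at least one of a₀b₁−a₁b₀, a₁b₂−a₂b₁, a₂b₀−a₀b₂ is a unit). Then there exists a line through both points: a vector λ ∈ R³ with at least one coordinate a unit such that λ₀a₀+λ₁a₁+λ₂a₂ = 0 and λ₀b₀+λ₁b₁+λ₂b₂ = 0. Moreover this line is unique: any vector μ ∈ R³ with at least one coordinate a unit satisfying μ₀a₀+μ₁a₁+μ₂a₂ = 0 and μ₀b₀+μ₁b₁+μ₂b₂ = 0 is equal to u • λ for some unit u of R. -/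
/-- A vector in `R³` has at least one coordinate a unit, hence represents a point
(or line) of the projective plane over `R`. -/
def IsRep {R : Type*} [CommRing R] (a : Fin 3 → R) : Prop :=
  IsUnit (a 0) ∨ IsUnit (a 1) ∨ IsUnit (a 2)

/-- The bilinear pairing between a line and a point. -/
def dot {R : Type*} [CommRing R] (l a : Fin 3 → R) : R :=
  l 0 * a 0 + l 1 * a 1 + l 2 * a 2

/-- The points (or lines) represented by `a` and `b` are apart from each other. -/
def Apart {R : Type*} [CommRing R] (a b : Fin 3 → R) : Prop :=
  IsUnit (a 0 * b 1 - a 1 * b 0) ∨ IsUnit (a 1 * b 2 - a 2 * b 1) ∨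
    IsUnit (a 2 * b 0 - a 0 * b 2)

theorem exists_units_smul_eq_of_mul_eq_mul {R ι : Type*} [CommRing R] {l m : ι → R} {i j : ι}
    (hm : IsUnit (m i)) (hl : IsUnit (l j)) (h : ∀ k, m k * l j = m j * l k) :
    ∃ u : Rˣ, m = (u : R) • l := by
  obtain ⟨v, hv⟩ := hl
  have hk : ∀ k, m k = (m j * ↑v⁻¹) * l k := fun k => by
    rw [mul_right_comm, ← h k, ← hv, Units.mul_inv_cancel_right]
  have hu : IsUnit (m j * ↑v⁻¹) := isUnit_of_mul_isUnit_left (hk i ▸ hm)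
  exact ⟨hu.unit, funext hk⟩

theorem isRep_iff_exists_isUnit {R : Type*} [CommRing R] {a : Fin 3 → R} :
    IsRep a ↔ ∃ i, IsUnit (a i) := by
  simp [IsRep, Fin.exists_fin_succ]

open scoped Matrix in
theorem dot_eq_dotProduct {R : Type*} [CommRing R] (l a : Fin 3 → R) : dot l a = l ⬝ᵥ a := by
  simp [dot, Matrix.vec3_dotProduct]

open scoped Matrix in
theorem Apart.isRep_crossProduct {R : Type*} [CommRing R] {a b : Fin 3 → R} (h : Apart a b) :
    IsRep (a ⨯₃ b) := by
  simp only [IsRep, cross_apply, Matrix.cons_val]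
  unfold Apart at h
  tauto

open scoped Matrix in
/-- A vector orthogonal to both `a` and `b` is parallel to their cross product. -/
theorem mul_crossProduct_eq_mul_crossProduct {R : Type*} [CommRing R] {a b m : Fin 3 → R}
    (ha : dot m a = 0) (hb : dot m b = 0) (i j : Fin 3) :
    m i * (a ⨯₃ b) j = m j * (a ⨯₃ b) i := by
  unfold dot at ha hb
  fin_cases i <;> fin_cases j <;> simp [cross_apply] <;> grind

/-- Through two points of the projective plane over a commutative ring which are apart
from each other there is a line, and this line is unique up to a unit scalar. -/
theorem exists_unique_line_through_apart_points
    {R : Type*} [CommRing R] (a b : Fin 3 → R)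
    (ha : IsRep a) (hb : IsRep b) (hab : Apart a b) :
    ∃ l : Fin 3 → R, IsRep l ∧ dot l a = 0 ∧ dot l b = 0 ∧
      ∀ m : Fin 3 → R, IsRep m → dot m a = 0 → dot m b = 0 →
        ∃ u : Rˣ, m = (u : R) • l := by
  obtain ⟨j, hj⟩ := isRep_iff_exists_isUnit.mp hab.isRep_crossProduct
  refine ⟨crossProduct a b, hab.isRep_crossProduct, ?_, ?_, fun m hm hma hmb => ?_⟩
  · rw [dot_eq_dotProduct, dotProduct_comm, dot_self_cross]
  · rw [dot_eq_dotProduct, dotProduct_comm, dot_cross_self]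
  · obtain ⟨i, hi⟩ := isRep_iff_exists_isUnit.mp hm
    exact exists_units_smul_eq_of_mul_eq_mul hi hj
      fun k => mul_crossProduct_eq_mul_crossProduct hma hmb k j
end

section
/- Let R be a commutative ring, let a, b, c ∈ R³ represent points A, B, C of the projective plane over R with A and B apart from each other, and let λ ∈ R³ represent a line passing through both A and B (λ₀a₀+λ₁a₁+λ₂a₂ = 0 and λ₀b₀+λ₁b₁+λ₂b₂ = 0). Then C lies on this line, i.e. λ₀c₀+λ₁c₁+λ₂c₂ = 0, if and only if the determinant of the 3×3 matrix with columns a, b, c equals 0. -/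
/-- A line through `A` and `B` is proportional to the cross product of `a` and `b`: the
coordinates of `l`, scaled by the determinant of `a`, `b`, `c`, are those of the cross product,
scaled by `dot l c`. -/
theorem mul_det_eq_cross_mul_dot {R : Type*} [CommRing R] (a b c l : Fin 3 → R)
    (hal : dot l a = 0) (hbl : dot l b = 0) :
    let d := (Matrix.of ![![a 0, b 0, c 0], ![a 1, b 1, c 1], ![a 2, b 2, c 2]]).det
    l 0 * d = (a 1 * b 2 - a 2 * b 1) * dot l c ∧
      l 1 * d = (a 2 * b 0 - a 0 * b 2) * dot l c ∧
      l 2 * d = (a 0 * b 1 - a 1 * b 0) * dot l c := by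
  unfold dot at *
  simp only [Matrix.det_fin_three, Matrix.of_apply, Matrix.cons_val]
  refine ⟨?_, ?_, ?_⟩
  · linear_combination (c 1 * a 2 - c 2 * a 1) * hbl - (c 1 * b 2 - c 2 * b 1) * hal
  · linear_combination (c 2 * a 0 - c 0 * a 2) * hbl - (c 2 * b 0 - c 0 * b 2) * hal
  · linear_combination (c 0 * a 1 - c 1 * a 0) * hbl - (c 0 * b 1 - c 1 * b 0) * hal

/-- `C` lies on the line through the apart points `A` and `B` iff the determinant of the
matrix with columns `a`, `b`, `c` vanishes. -/
theorem mem_line_iff_det_eq_zero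
    {R : Type*} [CommRing R] (a b c l : Fin 3 → R)
    (ha : IsRep a) (hb : IsRep b) (hc : IsRep c) (hl : IsRep l)
    (hab : Apart a b) (hal : dot l a = 0) (hbl : dot l b = 0) :
    dot l c = 0 ↔
      (Matrix.of ![![a 0, b 0, c 0], ![a 1, b 1, c 1], ![a 2, b 2, c 2]]).det = 0 := by
  obtain ⟨h0, h1, h2⟩ := mul_det_eq_cross_mul_dot a b c l hal hbl
  constructor
  · intro h
    rw [h, mul_zero] at h0 h1 h2
    rcases hl with hu | hu | hu
    · exact hu.mul_right_eq_zero.mp h0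
    · exact hu.mul_right_eq_zero.mp h1
    · exact hu.mul_right_eq_zero.mp h2
  · intro h
    rw [h, mul_zero] at h0 h1 h2
    rcases hab with hu | hu | hu
    · exact hu.mul_right_eq_zero.mp h2.symm
    · exact hu.mul_right_eq_zero.mp h0.symm
    · exact hu.mul_right_eq_zero.mp h1.symm
end

section
/- Let R be a commutative ring, let a, b, c ∈ R³ represent points A, B, C of the projective plane over R with A and B apart from each other, and let λ ∈ R³ represent a line passing through both A and B (λ₀a₀+λ₁a₁+λ₂a₂ = 0 and λ₀b₀+λ₁b₁+λ₂b₂ = 0). Then λ₀c₀+λ₁c₁+λ₂c₂ = 0 if and only if there exist x, y ∈ R such that c = x • a + y • b (coordinatewise). -/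
/-- Cramer's rule: when a `2 × 2` minor of two vectors annihilated by a unimodular `l` is a unit,
every vector annihilated by `l` is a linear combination of them. -/
theorem exists_linear_combination_of_isUnit_minor {R : Type*} [CommRing R]
    {a₀ a₁ a₂ b₀ b₁ b₂ c₀ c₁ c₂ l₀ l₁ l₂ : R}
    (hu : IsUnit (a₀ * b₁ - a₁ * b₀)) (hl : IsUnit l₀ ∨ IsUnit l₁ ∨ IsUnit l₂)
    (ha : l₀ * a₀ + l₁ * a₁ + l₂ * a₂ = 0) (hb : l₀ * b₀ + l₁ * b₁ + l₂ * b₂ = 0)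
    (hc : l₀ * c₀ + l₁ * c₁ + l₂ * c₂ = 0) :
    ∃ x y : R, c₀ = x * a₀ + y * b₀ ∧ c₁ = x * a₁ + y * b₁ ∧ c₂ = x * a₂ + y * b₂ := by
  obtain ⟨v, hv⟩ := hu.exists_right_inv
  have hl₂ : IsUnit l₂ := by
    rcases hl with h | h | h
    · exact isUnit_of_dvd_unit
        ⟨v * (a₁ * b₂ - a₂ * b₁), by linear_combination (-l₀) * hv + v * b₁ * ha - v * a₁ * hb⟩ h
    · exact isUnit_of_dvd_unit
        ⟨v * (a₂ * b₀ - a₀ * b₂), by linear_combination (-l₁) * hv - v * b₀ * ha + v * a₀ * hb⟩ h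
    · exact h
  have h₀ : c₀ = v * (c₀ * b₁ - c₁ * b₀) * a₀ + v * (a₀ * c₁ - a₁ * c₀) * b₀ := by
    linear_combination (-c₀) * hv
  have h₁ : c₁ = v * (c₀ * b₁ - c₁ * b₀) * a₁ + v * (a₀ * c₁ - a₁ * c₀) * b₁ := by
    linear_combination (-c₁) * hv
  refine ⟨_, _, h₀, h₁, hl₂.mul_left_cancel ?_⟩
  linear_combination hc - v * (c₀ * b₁ - c₁ * b₀) * ha - v * (a₀ * c₁ - a₁ * c₀) * hb
    - l₀ * h₀ - l₁ * h₁

/-- `C` lies on the line through the apart points `A` and `B` iff `c` is an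
`R`-linear combination of `a` and `b`. -/
theorem mem_line_iff_linear_combination
    {R : Type*} [CommRing R] (a b c l : Fin 3 → R)
    (ha : IsRep a) (hb : IsRep b) (hc : IsRep c) (hl : IsRep l)
    (hab : Apart a b) (hal : dot l a = 0) (hbl : dot l b = 0) :
    dot l c = 0 ↔ ∃ x y : R, c = x • a + y • b := by
  unfold dot at *
  constructor
  · intro h
    suffices ∃ x y : R, c 0 = x * a 0 + y * b 0 ∧ c 1 = x * a 1 + y * b 1 ∧
        c 2 = x * a 2 + y * b 2 by
      obtain ⟨x, y, h₀, h₁, h₂⟩ := this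
      refine ⟨x, y, funext fun i => ?_⟩
      fin_cases i
      exacts [h₀, h₁, h₂]
    rcases hab with hu | hu | hu
    · exact exists_linear_combination_of_isUnit_minor hu hl hal hbl h
    · obtain ⟨x, y, h₁, h₂, h₀⟩ := exists_linear_combination_of_isUnit_minor
        (l₀ := l 1) (l₁ := l 2) (l₂ := l 0) (a₂ := a 0) (b₂ := b 0)
        (c₀ := c 1) (c₁ := c 2) (c₂ := c 0) hu (by unfold IsRep at hl; tauto)
        (by linear_combination hal) (by linear_combination hbl) (by linear_combination h)
      exact ⟨x, y, h₀, h₁, h₂⟩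
    · obtain ⟨x, y, h₂, h₀, h₁⟩ := exists_linear_combination_of_isUnit_minor
        (l₀ := l 2) (l₁ := l 0) (l₂ := l 1) (a₂ := a 1) (b₂ := b 1)
        (c₀ := c 2) (c₁ := c 0) (c₂ := c 1) hu (by unfold IsRep at hl; tauto)
        (by linear_combination hal) (by linear_combination hbl) (by linear_combination h)
      exact ⟨x, y, h₀, h₁, h₂⟩
  · rintro ⟨x, y, rfl⟩
    simp only [Pi.add_apply, Pi.smul_apply, smul_eq_mul]
    linear_combination x * hal + y * hbl
end

section
/- For a commutative ring R, the following are equivalent: (i) for all x, y ∈ R, if x + y is a unit then x is a unit or y is a unit; (ii) for all vectors a, b, c ∈ R³ each having at least one coordinate a unit, if the points represented by a and b are apart from each other, then the points represented by a and c are apart or the points represented by b and c are apart. -/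
/-- Two points are apart iff some `2 × 2` minor of their representatives is a unit. -/
theorem apart_iff_exists_isUnit_minor {R : Type*} [CommRing R] {a b : Fin 3 → R} :
    Apart a b ↔ (∃ i j, IsUnit (a i * b j - a j * b i)) := by
  constructor
  · rintro (h | h | h)
    exacts [⟨0, 1, h⟩, ⟨1, 2, h⟩, ⟨2, 0, h⟩]
  · rintro ⟨i, j, h⟩
    have swap : ∀ i j, IsUnit (a i * b j - a j * b i) → IsUnit (a j * b i - a i * b j) := by
      intro i j h
      simpa using h.neg
    have diag : ∀ i, IsUnit (a i * b i - a i * b i) → IsUnit (a 0 * b 1 - a 1 * b 0) := by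
      intro i h
      rw [sub_self, isUnit_zero_iff] at h
      have := subsingleton_of_zero_eq_one h
      exact isUnit_of_subsingleton _
    fin_cases i <;> fin_cases j
    exacts [.inl (diag 0 h), .inl h, .inr (.inr (swap 0 2 h)), .inl (swap 1 0 h),
      .inl (diag 1 h), .inr (.inl h), .inr (.inr h), .inr (.inl (swap 2 1 h)), .inl (diag 2 h)]

/-- A representative has some unit coordinate. -/
theorem IsRep.exists_isUnit {R : Type*} [CommRing R] {a : Fin 3 → R} (h : IsRep a) :
    ∃ i, IsUnit (a i) := by
  rcases h with h | h | h
  exacts [⟨0, h⟩, ⟨1, h⟩, ⟨2, h⟩]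

/-- A commutative ring satisfies `IsUnit (x + y) → IsUnit x ∨ IsUnit y` iff the apartness
relation on points of its projective plane is cotransitive. -/
theorem addUnit_iff_apart_cotransitive {R : Type*} [CommRing R] :
    (∀ x y : R, IsUnit (x + y) → IsUnit x ∨ IsUnit y) ↔
      (∀ a b c : Fin 3 → R, IsRep a → IsRep b → IsRep c →
        Apart a b → Apart a c ∨ Apart b c) := by
  constructor
  · intro H a b c _ _ hc hab
    obtain ⟨k, hk⟩ := hc.exists_isUnit
    obtain ⟨i, j, hij⟩ := apart_iff_exists_isUnit_minor.1 hab
    simp only [apart_iff_exists_isUnit_minor]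
    have key : c k * (a i * b j - a j * b i) =
        a k * (b j * c i - b i * c j) + b j * (a i * c k - a k * c i) +
          b i * (a k * c j - a j * c k) := by ring
    rcases H _ _ (key ▸ hk.mul hij) with h | h
    · rcases H _ _ h with h | h
      · exact .inr ⟨j, i, isUnit_of_mul_isUnit_right h⟩
      · exact .inl ⟨i, k, isUnit_of_mul_isUnit_right h⟩
    · exact .inl ⟨k, j, isUnit_of_mul_isUnit_right h⟩
  · intro H x y hxy
    have rep : ∀ t : R, IsRep ![1, t, 0] := fun t => .inl (by simp)
    have apart_iff : ∀ s t : R, Apart ![1, s, 0] ![1, t, 0] ↔ IsUnit (t - s) := by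
      intro s t
      simp only [Apart, Matrix.cons_val, one_mul, mul_one, mul_zero, zero_mul, sub_self, or_self,
        or_iff_left_iff_imp, isUnit_zero_iff]
      intro h
      have := subsingleton_of_zero_eq_one h
      exact isUnit_of_subsingleton _
    have h := H _ _ _ (rep 0) (rep (x + y)) (rep x) ((apart_iff _ _).2 (by simpa using hxy))
    simpa [apart_iff] using h
end

section
/- For a commutative ring R, the following are equivalent: (i) for all x, y ∈ R, if x + y is a unit then x is a unit or y is a unit; (ii) for all vectors a, b ∈ R³ representing points A, B and every vector κ ∈ R³ representing a line k of the projective plane over R, if A lies outside k (κ₀a₀+κ₁a₁+κ₂a₂ is a unit), then A and B are apart from each other or B lies outside k (κ₀b₀+κ₁b₁+κ₂b₂ is a unit). -/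
/-- If sums being units forces a summand to be a unit, then the same holds for a combination
`u * x + v * y + w * z`, with a unit among `x`, `y`, `z`. -/
theorem isUnit_or_of_isUnit_combination {R : Type*} [CommRing R]
    (h : ∀ x y : R, IsUnit (x + y) → IsUnit x ∨ IsUnit y) {u v w x y z : R}
    (hu : IsUnit (u * x + v * y + w * z)) : IsUnit x ∨ IsUnit y ∨ IsUnit z := by
  rcases h _ _ hu with hxy | hz
  · rcases h _ _ hxy with hx | hy
    · exact Or.inl (isUnit_of_mul_isUnit_right hx)
    · exact Or.inr (Or.inl (isUnit_of_mul_isUnit_right hy))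
  · exact Or.inr (Or.inr (isUnit_of_mul_isUnit_right hz))

/-- A commutative ring satisfies `IsUnit (x + y) → IsUnit x ∨ IsUnit y` iff its projective
plane satisfies: whenever `A ∉ k`, for every point `B` either `A # B` or `B ∉ k`. -/
theorem addUnit_iff_outside_cotransitive {R : Type*} [CommRing R] :
    (∀ x y : R, IsUnit (x + y) → IsUnit x ∨ IsUnit y) ↔
      (∀ a b k : Fin 3 → R, IsRep a → IsRep b → IsRep k →
        IsUnit (dot k a) → Apart a b ∨ IsUnit (dot k b)) := by
  constructor
  · intro h a b k _ hb _ hka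
    unfold Apart
    rcases hb with hb | hb | hb
    · have key : IsUnit (a 0 * dot k b + (-k 1) * (a 0 * b 1 - a 1 * b 0) + k 2 * (a 2 * b 0 - a 0 * b 2)) := by
        convert hb.mul hka using 1
        simp only [dot]
        ring
      have := isUnit_or_of_isUnit_combination h key
      tauto
    · have key : IsUnit (a 1 * dot k b + k 0 * (a 0 * b 1 - a 1 * b 0) + (-k 2) * (a 1 * b 2 - a 2 * b 1)) := by
        convert hb.mul hka using 1
        simp only [dot]
        ring
      have := isUnit_or_of_isUnit_combination h key
      tauto
    · have key : IsUnit (a 2 * dot k b + k 1 * (a 1 * b 2 - a 2 * b 1) + (-k 0) * (a 2 * b 0 - a 0 * b 2)) := by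
        convert hb.mul hka using 1
        simp only [dot]
        ring
      have := isUnit_or_of_isUnit_combination h key
      tauto
  · intro h x y hxy
    have := h ![1, 0, 0] ![1, y, 0] ![x + y, -1, 0] (by simp [IsRep]) (by simp [IsRep])
      (Or.inl (by simpa using hxy)) (by simpa [dot] using hxy)
    rcases this with (hy | h0 | h0) | hx
    · exact Or.inr (by simpa using hy)
    · exact Or.inl (isUnit_of_mul_isUnit_right (x := 0) (by simpa using h0))
    · exact Or.inl (isUnit_of_mul_isUnit_right (x := 0) (by simpa using h0))
    · exact Or.inl (by simpa [dot] using hx)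
end

section
/- Let R be a local ring. The projective plane over R satisfies that any two points lie on a common line (i.e., for all a, b ∈ R³ each with at least one coordinate a unit there exists λ ∈ R³ with at least one coordinate a unit such that λ₀a₀+λ₁a₁+λ₂a₂ = 0 and λ₀b₀+λ₁b₁+λ₂b₂ = 0) if and only if R satisfies: for all a, b ∈ R there exists x ∈ R with a·x = b or a = b·x. -/
/-- If divisibility is total, then two points, the first of which has a unit as its leading
coordinate, lie on a common line. -/
lemma exists_line_of_isUnit {R : Type*} [CommRing R]
    (h : ∀ a b : R, ∃ x : R, a * x = b ∨ a = b * x)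
    {a₀ : R} (ha : IsUnit a₀) (a₁ a₂ b₀ b₁ b₂ : R) :
    ∃ l₀ l₁ l₂ : R, (IsUnit l₁ ∨ IsUnit l₂) ∧
      l₀ * a₀ + l₁ * a₁ + l₂ * a₂ = 0 ∧ l₀ * b₀ + l₁ * b₁ + l₂ * b₂ = 0 := by
  obtain ⟨v, hv⟩ := ha.exists_right_inv
  obtain ⟨x, hx | hx⟩ := h (b₁ - b₀ * v * a₁) (b₂ - b₀ * v * a₂)
  · refine ⟨-v * (x * a₁ - a₂), x, -1, Or.inr isUnit_one.neg, ?_, ?_⟩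
    · linear_combination (-(x * a₁ - a₂)) * hv
    · linear_combination hx
  · refine ⟨-v * (a₁ - x * a₂), 1, -x, Or.inl isUnit_one, ?_, ?_⟩
    · linear_combination (-(a₁ - x * a₂)) * hv
    · linear_combination hx

/-- For a local ring `R`, any two points of the projective plane over `R` lie on a common
line iff for all `a b : R` there is `x` with `a * x = b` or `a = b * x`. -/
theorem line_through_any_two_points_iff {R : Type*} [CommRing R] [IsLocalRing R] :
    (∀ a b : Fin 3 → R, IsRep a → IsRep b →
      ∃ l : Fin 3 → R, IsRep l ∧ dot l a = 0 ∧ dot l b = 0) ↔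
      (∀ a b : R, ∃ x : R, a * x = b ∨ a = b * x) := by
  constructor
  · intro h a b
    obtain ⟨l, hl, h₁, h₂⟩ := h ![1, 0, 0] ![1, a, b] (by simp [IsRep]) (by simp [IsRep])
    have h₀ : l 0 = 0 := by simpa [dot] using h₁
    have hab : l 1 * a + l 2 * b = 0 := by simpa [dot, h₀] using h₂
    rcases hl with hu | hu | hu
    · rw [h₀] at hu
      exact absurd hu not_isUnit_zero
    · obtain ⟨v, hv⟩ := hu.exists_right_inv
      exact ⟨-(v * l 2), Or.inr (by linear_combination v * hab - a * hv)⟩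
    · obtain ⟨v, hv⟩ := hu.exists_right_inv
      exact ⟨-(v * l 1), Or.inl (by linear_combination b * hv - v * hab)⟩
  · intro h a b ha _
    rcases ha with ha | ha | ha
    · obtain ⟨x, y, z, hu, h₁, h₂⟩ :=
        exists_line_of_isUnit h ha (a 1) (a 2) (b 0) (b 1) (b 2)
      exact ⟨![x, y, z], Or.inr hu, h₁, h₂⟩
    · obtain ⟨y, z, x, hu, h₁, h₂⟩ :=
        exists_line_of_isUnit h ha (a 2) (a 0) (b 1) (b 2) (b 0)
      refine ⟨![x, y, z], hu.elim (fun hz => Or.inr (Or.inr hz)) Or.inl, ?_, ?_⟩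
      · change x * a 0 + y * a 1 + z * a 2 = 0
        linear_combination h₁
      · change x * b 0 + y * b 1 + z * b 2 = 0
        linear_combination h₂
    · obtain ⟨z, x, y, hu, h₁, h₂⟩ :=
        exists_line_of_isUnit h ha (a 0) (a 1) (b 2) (b 0) (b 1)
      refine ⟨![x, y, z], hu.imp_right Or.inl, ?_, ?_⟩
      · change x * a 0 + y * a 1 + z * a 2 = 0
        linear_combination h₁
      · change x * b 0 + y * b 1 + z * b 2 = 0
        linear_combination h₂
end

section
/- Let R be a local ring. The projective plane over R satisfies that, for every point A lying on a line l and every point B apart from A, B lies on l or B lies outside l (i.e., for all a, b ∈ R³ representing apart points A, B and every λ ∈ R³ representing a line with λ·a = 0, either λ·b = 0 or λ·b is a unit) if and only if R is a geometric field, i.e. every element of R is either 0 or a unit. -/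
/-- For a local ring `R`, the projective plane over `R` satisfies that for a point `A` on a
line `l` and a point `B` apart from `A`, either `B ∈ l` or `B ∉ l`, iff `R` is a geometric
field (every element is zero or a unit). -/
theorem decidable_incidence_iff_field {R : Type*} [CommRing R] [IsLocalRing R] :
    (∀ a b l : Fin 3 → R, IsRep a → IsRep b → IsRep l →
      Apart a b → dot l a = 0 → dot l b = 0 ∨ IsUnit (dot l b)) ↔
      (∀ x : R, x = 0 ∨ IsUnit x) := by
  refine ⟨fun h x => ?_, fun h _ b l _ _ _ _ _ => h (dot l b)⟩
  simpa [dot] using h ![1, 0, 0] ![0, 0, 1] ![0, 1, x] (by simp [IsRep]) (by simp [IsRep])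
    (by simp [IsRep]) (by simp [Apart]) (by simp [dot])
end

section
/- Let R be a local ring, let κ, λ ∈ R³ represent lines k, l and let a, b ∈ R³ represent points A, B of the projective plane over R. Suppose that k # l or A # B, and that at least one of κ·a, κ·b, λ·a, λ·b is a unit. Then δ(k,l,A,B) holds if and only if (κ·a)(λ·b) = (κ·b)(λ·a), where κ·a denotes κ₀a₀+κ₁a₁+κ₂a₂, etc. -/
/-- `Delta k l a b` : there exist a line `r` and a point `X` such that the points
`A`, `B`, `X` all lie on `r` and `X` lies on each of `k`, `l` and `r`. -/
def Delta {R : Type*} [CommRing R] (k l a b : Fin 3 → R) : Prop :=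
  ∃ r X : Fin 3 → R, IsRep r ∧ IsRep X ∧
    dot r a = 0 ∧ dot r b = 0 ∧ dot r X = 0 ∧ dot k X = 0 ∧ dot l X = 0

open scoped Matrix

theorem apart_iff_isRep_cross {R : Type*} [CommRing R] {a b : Fin 3 → R} :
    Apart a b ↔ IsRep (a ⨯₃ b) := by
  simp only [Apart, IsRep, cross_apply, Matrix.cons_val]
  tauto

theorem Apart.symm {R : Type*} [CommRing R] {a b : Fin 3 → R} (h : Apart a b) : Apart b a := by
  refine h.imp (fun h => ?_) (Or.imp (fun h => ?_) (fun h => ?_)) <;>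
    exact (IsUnit.neg_iff _).1 (by convert h using 1; ring)

theorem Apart.isRep_left {R : Type*} [CommRing R] [IsLocalRing R] {a b : Fin 3 → R}
    (h : Apart a b) : IsRep a := by
  have key : ∀ {x y z w : R}, IsUnit (x * y - z * w) → IsUnit x ∨ IsUnit z := by
    intro x y z w h
    rw [sub_eq_add_neg] at h
    refine (IsLocalRing.isUnit_or_isUnit_of_isUnit_add h).imp isUnit_of_mul_isUnit_left ?_
    exact fun h => isUnit_of_mul_isUnit_left ((IsUnit.neg_iff _).1 h)
  unfold IsRep
  rcases h with h | h | h <;> have := key h <;> tauto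

/-- A combination of two apart vectors with a unit coefficient is apart from one of them. -/
theorem Apart.sub_smul_left {R : Type*} [CommRing R] {v w : Fin 3 → R} (h : Apart v w)
    {c : R} (hc : IsUnit c) (d : R) : Apart (d • v - c • w) v := by
  refine h.imp (fun h => ?_) (Or.imp (fun h => ?_) (fun h => ?_)) <;>
  · convert hc.mul h using 1
    simp only [Pi.sub_apply, Pi.smul_apply, smul_eq_mul]
    ring

/-- Two vectors orthogonal to a unimodular vector have cross product a multiple of it. -/
theorem IsRep.exists_cross_eq_smul {R : Type*} [CommRing R] {r a b : Fin 3 → R} (hr : IsRep r)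
    (ha : dot r a = 0) (hb : dot r b = 0) : ∃ t : R, a ⨯₃ b = t • r := by
  have h : ∀ i j, r i * (a ⨯₃ b) j = r j * (a ⨯₃ b) i := by
    unfold dot at ha hb
    intro i j
    fin_cases i <;> fin_cases j <;> simp [cross_apply] <;> grind
  obtain ⟨i, u, hu⟩ : ∃ i, IsUnit (r i) := by
    rcases hr with h | h | h <;> exact ⟨_, h⟩
  refine ⟨↑u⁻¹ * (a ⨯₃ b) i, funext fun j => ?_⟩
  have := h i j
  rw [← hu] at this
  rw [Pi.smul_apply, smul_eq_mul, mul_assoc, mul_comm _ (r j), ← this, Units.inv_mul_cancel_left]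

theorem dot_comm {R : Type*} [CommRing R] (l a : Fin 3 → R) : dot l a = dot a l := by
  unfold dot
  ring

theorem dot_smul_smul {R : Type*} [CommRing R] (s t : R) (v w : Fin 3 → R) :
    dot (s • v) (t • w) = s * t * dot v w := by
  simp only [dot, Pi.smul_apply, smul_eq_mul]
  ring

theorem dot_cross_cross {R : Type*} [CommRing R] (k l a b : Fin 3 → R) :
    dot (k ⨯₃ l) (a ⨯₃ b) = dot k a * dot l b - dot k b * dot l a := by
  simp only [dot, cross_apply, Matrix.cons_val]
  ring

theorem Delta.det_eq_zero {R : Type*} [CommRing R] {k l a b : Fin 3 → R} (h : Delta k l a b) :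
    dot k a * dot l b = dot k b * dot l a := by
  obtain ⟨r, X, hr, hX, ha, hb, hrX, hkX, hlX⟩ := h
  obtain ⟨t, ht⟩ := hr.exists_cross_eq_smul ha hb
  obtain ⟨s, hs⟩ := hX.exists_cross_eq_smul ((dot_comm _ _).trans hkX) ((dot_comm _ _).trans hlX)
  rw [← sub_eq_zero, ← dot_cross_cross, hs, ht, dot_smul_smul, dot_comm, hrX, mul_zero]

theorem Delta.swap_lines {R : Type*} [CommRing R] {k l a b : Fin 3 → R} (h : Delta k l a b) :
    Delta l k a b := by
  obtain ⟨r, X, hr, hX, ha, hb, hrX, hkX, hlX⟩ := h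
  exact ⟨r, X, hr, hX, ha, hb, hrX, hlX, hkX⟩

theorem Delta.swap_points {R : Type*} [CommRing R] {k l a b : Fin 3 → R} (h : Delta k l a b) :
    Delta k l b a := by
  obtain ⟨r, X, hr, hX, ha, hb, hrX, hkX, hlX⟩ := h
  exact ⟨r, X, hr, hX, hb, ha, hrX, hkX, hlX⟩

/-- Interchanging the roles of points and lines. -/
theorem Delta.dual {R : Type*} [CommRing R] {k l a b : Fin 3 → R} (h : Delta k l a b) :
    Delta a b k l := by
  obtain ⟨r, X, hr, hX, ha, hb, hrX, hkX, hlX⟩ := h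
  refine ⟨X, r, hX, hr, ?_, ?_, ?_, ?_, ?_⟩ <;> rw [dot_comm] <;> assumption

theorem Apart.delta {R : Type*} [CommRing R] [IsLocalRing R] {k l a b : Fin 3 → R}
    (hkl : Apart k l) (hka : IsUnit (dot k a))
    (hdet : dot k a * dot l b = dot k b * dot l a) : Delta k l a b := by
  refine ⟨dot l a • k - dot k a • l, k ⨯₃ l, (hkl.sub_smul_left hka _).isRep_left,
    apart_iff_isRep_cross.1 hkl, ?_, ?_, ?_, ?_, ?_⟩ <;>
  simp only [dot, cross_apply, Matrix.cons_val, Pi.sub_apply, Pi.smul_apply, smul_eq_mul] at hdet ⊢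
  on_goal 2 => linear_combination -hdet
  all_goals ring

theorem delta_of_isUnit_dot {R : Type*} [CommRing R] [IsLocalRing R] {k l a b : Fin 3 → R}
    (hap : Apart k l ∨ Apart a b) (hka : IsUnit (dot k a))
    (hdet : dot k a * dot l b = dot k b * dot l a) : Delta k l a b := by
  rcases hap with h | h
  · exact h.delta hka hdet
  · refine (h.delta (dot_comm k a ▸ hka) ?_).dual
    rw [dot_comm a k, dot_comm b l, dot_comm a l, dot_comm b k, hdet, mul_comm]

/-- If `k # l` or `A # B`, and at least one of the points `A`, `B` lies outside at least
one of the lines `k`, `l`, then `δ(k,l,A,B)` holds iff `(κ·a)(λ·b) = (κ·b)(λ·a)`. -/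
theorem delta_iff_det_eq_zero {R : Type*} [CommRing R] [IsLocalRing R]
    (k l a b : Fin 3 → R)
    (hk : IsRep k) (hl : IsRep l) (ha : IsRep a) (hb : IsRep b)
    (hap : Apart k l ∨ Apart a b)
    (hout : IsUnit (dot k a) ∨ IsUnit (dot k b) ∨ IsUnit (dot l a) ∨ IsUnit (dot l b)) :
    Delta k l a b ↔ dot k a * dot l b = dot k b * dot l a := by
  refine ⟨Delta.det_eq_zero, fun hdet => ?_⟩
  rcases hout with h | h | h | h
  · exact delta_of_isUnit_dot hap h hdet
  · exact (delta_of_isUnit_dot (hap.imp_right Apart.symm) h hdet.symm).swap_points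
  · exact (delta_of_isUnit_dot (hap.imp_left Apart.symm) h
      (by linear_combination -hdet)).swap_lines
  · exact (delta_of_isUnit_dot (hap.imp Apart.symm Apart.symm) h
      (by linear_combination hdet)).swap_lines.swap_points
end

section
/- Let R be a local ring and let a, b, c, d ∈ R³ represent four points of the projective plane over R in general position, i.e. each of the four determinants det(a,b,c), det(a,b,d), det(a,c,d), det(b,c,d) (of the 3×3 matrices with the indicated columns) is a unit of R. Then there exist an invertible 3×3 matrix M over R and units r₁, r₂, r₃, r₄ of R such that the columns of M are r₁•a, r₂•b, r₃•c and M·(1,1,1) = r₄•d. Moreover M is unique up to a unit scalar: if N is another invertible 3×3 matrix over R whose columns are unit multiples of a, b, c respectively and with N·(1,1,1) a unit multiple of d, then N = u•M for some unit u of R. -/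
/-- The determinant of the `3 × 3` matrix with columns `a`, `b`, `c`. -/
def cdet {R : Type*} [CommRing R] (a b c : Fin 3 → R) : R :=
  ((Matrix.of ![a, b, c]).transpose).det

theorem cdet_eq {R : Type*} [CommRing R] (a b c : Fin 3 → R) :
    cdet a b c = a 0 * (b 1 * c 2 - b 2 * c 1) - a 1 * (b 0 * c 2 - b 2 * c 0) +
      a 2 * (b 0 * c 1 - b 1 * c 0) := by
  simp [cdet, Matrix.det_fin_three]
  ring

/-- Cramer's rule: four vectors of `R³` satisfy a linear relation whose coefficients are the
determinants of the triples among them. -/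
theorem cdet_mul_apply {R : Type*} [CommRing R] (a b c d : Fin 3 → R) (i : Fin 3) :
    cdet b c d * a i + -cdet a c d * b i + cdet a b d * c i = cdet a b c * d i := by
  simp only [cdet_eq]
  fin_cases i <;> simp <;> ring

/-- The coefficients of a linear relation between four vectors of `R³` are proportional to the
determinants of the triples among them. -/
theorem mul_cdet_of_linear_relation {R : Type*} [CommRing R] {a b c d : Fin 3 → R} {x y z w : R}
    (h : ∀ i, x * a i + y * b i + z * c i = w * d i) :
    x * cdet a b c = w * cdet b c d ∧ y * cdet a b c = w * -cdet a c d ∧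
      z * cdet a b c = w * cdet a b d := by
  simp only [cdet_eq]
  refine ⟨?_, ?_, ?_⟩
  · linear_combination (b 1 * c 2 - b 2 * c 1) * h 0 - (b 0 * c 2 - b 2 * c 0) * h 1 +
      (b 0 * c 1 - b 1 * c 0) * h 2
  · linear_combination -(a 1 * c 2 - a 2 * c 1) * h 0 + (a 0 * c 2 - a 2 * c 0) * h 1 -
      (a 0 * c 1 - a 1 * c 0) * h 2
  · linear_combination (a 1 * b 2 - a 2 * b 1) * h 0 - (a 0 * b 2 - a 2 * b 0) * h 1 +
      (a 0 * b 1 - a 1 * b 0) * h 2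

theorem cdet_smul {R : Type*} [CommRing R] (x y z : R) (a b c : Fin 3 → R) :
    cdet (x • a) (y • b) (z • c) = x * y * z * cdet a b c := by
  simp only [cdet_eq, Pi.smul_apply, smul_eq_mul]
  ring

/-- Given four points of the projective plane over a local ring in general position, there
is an invertible matrix whose columns are unit multiples of `a`, `b`, `c` and which sends
`(1,1,1)` to a unit multiple of `d`; this matrix is unique up to a unit scalar. -/
theorem exists_unique_matrix_of_general_position
    {R : Type*} [CommRing R] [IsLocalRing R] (a b c d : Fin 3 → R)
    (h1 : IsUnit (cdet a b c)) (h2 : IsUnit (cdet a b d))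
    (h3 : IsUnit (cdet a c d)) (h4 : IsUnit (cdet b c d)) :
    ∃ M : Matrix (Fin 3) (Fin 3) R, IsUnit M.det ∧
      (∃ r1 r2 r3 r4 : Rˣ,
        (∀ i, M i 0 = (r1 : R) * a i) ∧ (∀ i, M i 1 = (r2 : R) * b i) ∧
        (∀ i, M i 2 = (r3 : R) * c i) ∧
        (M.mulVec (fun _ => 1) = fun i => (r4 : R) * d i)) ∧
      ∀ N : Matrix (Fin 3) (Fin 3) R, IsUnit N.det →
        (∃ s1 s2 s3 s4 : Rˣ,
          (∀ i, N i 0 = (s1 : R) * a i) ∧ (∀ i, N i 1 = (s2 : R) * b i) ∧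
          (∀ i, N i 2 = (s3 : R) * c i) ∧
          (N.mulVec (fun _ => 1) = fun i => (s4 : R) * d i)) →
        ∃ u : Rˣ, N = (u : R) • M := by
  refine ⟨(Matrix.of ![cdet b c d • a, (-cdet a c d) • b, cdet a b d • c]).transpose, ?_,
    ⟨h4.unit, h3.neg.unit, h2.unit, h1.unit, fun i => ?_, fun i => ?_, fun i => ?_, ?_⟩, ?_⟩
  · change IsUnit (cdet _ _ _)
    rw [cdet_smul]
    exact ((h4.mul h3.neg).mul h2).mul h1
  · simp
  · simp
  · simp
  · ext i
    simpa [Matrix.mulVec, dotProduct, Fin.sum_univ_three] using cdet_mul_apply a b c d i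
  · rintro N - ⟨s1, s2, s3, s4, ha, hb, hc, hd⟩
    have hrel : ∀ i, (s1 : R) * a i + s2 * b i + s3 * c i = s4 * d i := fun i => by
      simpa [Matrix.mulVec, dotProduct, Fin.sum_univ_three, ha, hb, hc] using congrFun hd i
    obtain ⟨e1, e2, e3⟩ := mul_cdet_of_linear_relation hrel
    have hu : (↑h1.unit⁻¹ : R) * cdet a b c = 1 := h1.val_inv_mul
    refine ⟨s4 * h1.unit⁻¹, ?_⟩
    ext i j
    fin_cases j
    · simp [ha]
      linear_combination ↑h1.unit⁻¹ * a i * e1 - s1 * a i * hu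
    · simp [hb]
      linear_combination ↑h1.unit⁻¹ * b i * e2 - s2 * b i * hu
    · simp [hc]
      linear_combination ↑h1.unit⁻¹ * c i * e3 - s3 * c i * hu
end

section
/- Let A be a commutative ring and let P be a polynomial in A[X] such that for every commutative ring B and every ring homomorphism f : A → B, the map B → B sending b to the evaluation at b of the polynomial obtained by applying f to the coefficients of P is a bijective ring homomorphism. Then P = X. (This expresses that the internal automorphism group of the generic ring is trivial.) -/
universe u

open Polynomial in
/-- The coefficients of a polynomial that is multiplicative at two independent variables
are idempotent. -/
theorem coeff_isIdempotentElem_of_eval_mul {A : Type*} [CommRing A] (P : A[X])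
    (h : ((P.map C).map C).eval (C X * X : A[X][X]) =
      ((P.map C).map C).eval (C X) * ((P.map C).map C).eval X) (n : ℕ) :
    IsIdempotentElem (P.coeff n) := by
  have eval_C_eq : ((P.map C).map C).eval (C X : A[X][X]) = C P := by
    rw [eval_map, eval₂_at_apply, eval_map, eval₂_C_X]
  have eval_X_eq : ((P.map C).map C).eval (X : A[X][X]) = P.map C := by
    rw [eval_map, eval₂_C_X]
  have comp_eq : (P.map C).comp (C X * X) = C P * P.map C := by
    rw [eval_C_eq, eval_X_eq, eval_map] at h
    exact h
  have coeff_eq := congrArg (fun q : A[X][X] => (q.coeff n).coeff n) comp_eq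
  simp only [comp_C_mul_X_coeff, coeff_C_mul, coeff_map, coeff_mul_C, coeff_X_pow_self,
    mul_one] at coeff_eq
  exact coeff_eq.symm

open Polynomial in
/-- Over a domain, a polynomial that takes the value `X` on polynomials is of degree one. -/
theorem natDegree_eq_one_of_comp_eq_X {R : Type*} [CommRing R] [IsDomain R] {P Q : R[X]}
    (h : P.comp Q = X) : P.natDegree = 1 := by
  have hdeg := congrArg natDegree h
  rw [natDegree_comp, natDegree_X] at hdeg
  exact Nat.eq_one_of_mul_eq_one_right hdeg

/-- An idempotent lying in every maximal ideal vanishes. -/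
theorem IsIdempotentElem.eq_zero_of_forall_mem_isMaximal {A : Type*} [CommRing A] {e : A}
    (he : IsIdempotentElem e) (hmem : ∀ m : Ideal A, m.IsMaximal → e ∈ m) : e = 0 := by
  have hunit : IsUnit (1 - e) := by
    by_contra hnot
    obtain ⟨m, hm, hem⟩ := exists_max_ideal_of_mem_nonunits hnot
    exact hm.ne_top ((Ideal.eq_top_iff_one m).2 (by simpa using m.add_mem hem (hmem m hm)))
  exact hunit.mul_left_cancel (by rw [sub_mul, one_mul, he.eq, sub_self, mul_zero])

/-- The internal automorphism group of the generic ring is trivial: if `P ∈ A[X]` is such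
that for every commutative ring `B` and every ring homomorphism `f : A → B`, evaluation of
the polynomial obtained by applying `f` to the coefficients of `P` is a bijective ring
endomorphism of `B`, then `P = X`. -/
theorem generic_ring_automorphism_trivial
    {A : Type u} [CommRing A] (P : Polynomial A)
    (h : ∀ (B : Type u) [CommRing B] (f : A →+* B),
      Function.Bijective (fun b : B => (P.map f).eval b) ∧
      (P.map f).eval (0 : B) = 0 ∧
      (P.map f).eval (1 : B) = 1 ∧
      (∀ x y : B, (P.map f).eval (x + y) = (P.map f).eval x + (P.map f).eval y) ∧
      (∀ x y : B, (P.map f).eval (x * y) = (P.map f).eval x * (P.map f).eval y)) :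
    P = Polynomial.X := by
  have coeff_eq_zero (n : ℕ) (hn : 1 < n) : P.coeff n = 0 := by
    refine IsIdempotentElem.eq_zero_of_forall_mem_isMaximal
      (coeff_isIdempotentElem_of_eval_mul P ?_ n) fun m hm => ?_
    · have hmul := (h _ (Polynomial.C.comp (Polynomial.C : A →+* Polynomial A))).2.2.2.2
        (Polynomial.C Polynomial.X) Polynomial.X
      rwa [← Polynomial.map_map] at hmul
    · let π := Ideal.Quotient.mk m
      obtain ⟨Q, hQ⟩ := (h _ ((Polynomial.C : A ⧸ m →+* _).comp π)).1.2 Polynomial.X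
      have hcomp : (P.map π).comp Q = Polynomial.X := by
        rw [← hQ, Polynomial.comp, ← Polynomial.map_map]
        exact (Polynomial.eval_map _ _).symm
      rw [← Ideal.Quotient.eq_zero_iff_mem]
      change π (P.coeff n) = 0
      rw [← Polynomial.coeff_map]
      exact Polynomial.coeff_eq_zero_of_natDegree_lt
        (by rwa [natDegree_eq_one_of_comp_eq_X hcomp])
  obtain ⟨-, eval_zero, eval_one, -⟩ := h A (RingHom.id A)
  rw [Polynomial.map_id] at eval_zero eval_one
  have hlin := Polynomial.eq_X_add_C_of_natDegree_le_one
    (Polynomial.natDegree_le_iff_coeff_eq_zero.2 coeff_eq_zero)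
  have coeff_zero : P.coeff 0 = 0 := by rwa [Polynomial.coeff_zero_eq_eval_zero]
  rw [coeff_zero] at hlin
  have coeff_one : P.coeff 1 = 1 := by
    rw [hlin] at eval_one
    simpa using eval_one
  simpa [coeff_one] using hlin
end

section
/- Let R be a local ring. A function σ : R² → R² is a dilatation of the affine plane over R — meaning that for all points P = (p₀,p₁) and Q = (q₀,q₁) with P # Q (that is, p₀−q₀ is a unit or p₁−q₁ is a unit), one has σ(P) # σ(Q) and the line through P and Q is parallel to the line through σ(P) and σ(Q), i.e. (q₁−p₁)·(σ(Q)₀−σ(P)₀) = (q₀−p₀)·(σ(Q)₁−σ(P)₁) — if and only if there exist a unit r of R and elements s, t ∈ R such that σ(x,y) = (r·x + s, r·y + t) for all (x,y) ∈ R². -/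
/-- In a local ring, an element whose difference from a unit is not a unit is a unit. -/
theorem isUnit_of_not_isUnit_sub {R : Type*} [CommRing R] [IsLocalRing R] {x u : R}
    (hu : IsUnit u) (h : ¬ IsUnit (x - u)) : IsUnit x := by
  have hsum : IsUnit (x + -(x - u)) := by simpa using hu
  exact (IsLocalRing.isUnit_or_isUnit_of_isUnit_add hsum).resolve_right
    fun h' => h (by simpa using h'.neg)

/-- Let `(a, b)` be the image of `(x, y)` under a map that fixes the origin, sends `(1, 0)` and
`(0, 1)` to `(r, 0)` and `(0, r)`, and sends the line through `(x, y)` and any of these three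
points apart from it to a parallel line. Then `(a, b) = (r * x, r * y)`. -/
theorem eq_mul_of_parallel_to_frame {R : Type*} [CommRing R] [IsLocalRing R] {r x y a b : R}
    (h₀ : IsUnit x ∨ IsUnit y → y * a = x * b)
    (h₁ : IsUnit (x - 1) ∨ IsUnit y → y * (a - r) = (x - 1) * b)
    (h₂ : IsUnit x ∨ IsUnit (y - 1) → (y - 1) * a = x * (b - r)) :
    a = r * x ∧ b = r * y := by
  by_cases c₀ : IsUnit x ∨ IsUnit y
  · have e₀ := h₀ c₀
    by_cases c₁ : IsUnit (x - 1) ∨ IsUnit y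
    · have hb : b = r * y := by linear_combination h₁ c₁ - e₀
      refine ⟨?_, hb⟩
      by_cases c₂ : IsUnit x ∨ IsUnit (y - 1)
      · linear_combination e₀ - h₂ c₂
      · have hy : IsUnit y := isUnit_of_not_isUnit_sub isUnit_one fun h => c₂ (Or.inr h)
        apply hy.mul_left_cancel
        linear_combination e₀ + x * hb
    · have hx : IsUnit x := isUnit_of_not_isUnit_sub isUnit_one fun h => c₁ (Or.inl h)
      have ha : a = r * x := by linear_combination e₀ - h₂ (Or.inl hx)
      refine ⟨ha, ?_⟩
      apply hx.mul_left_cancel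
      linear_combination -e₀ + y * ha
  · rw [not_or] at c₀
    have hx : IsUnit (x - 1) := by
      by_contra h
      exact c₀.1 (isUnit_of_not_isUnit_sub isUnit_one h)
    have hy : IsUnit (y - 1) := by
      by_contra h
      exact c₀.2 (isUnit_of_not_isUnit_sub isUnit_one h)
    have hxy : IsUnit (x + y - 1) := by
      by_contra h
      exact (IsLocalRing.isUnit_or_isUnit_of_isUnit_add
        (isUnit_of_not_isUnit_sub isUnit_one h)).elim c₀.1 c₀.2
    have e₁ := h₁ (Or.inl hx)
    have e₂ := h₂ (Or.inr hy)
    have hb : b = r * y := by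
      apply hxy.mul_left_cancel
      linear_combination (y - 1) * e₁ - y * e₂
    exact ⟨by linear_combination e₁ - e₂ - hb, hb⟩

/-- A map `σ : R² → R²` is a dilatation of the affine plane over a local ring `R` (it
preserves apartness of points and sends the line through two apart points to a parallel
line) iff it is of the form `(x, y) ↦ (r·x + s, r·y + t)` for a unit `r` and `s, t ∈ R`. -/
theorem dilatation_iff_affine_form
    {R : Type*} [CommRing R] [IsLocalRing R] (σ : R × R → R × R) :
    (∀ P Q : R × R, (IsUnit (P.1 - Q.1) ∨ IsUnit (P.2 - Q.2)) →
      (IsUnit ((σ P).1 - (σ Q).1) ∨ IsUnit ((σ P).2 - (σ Q).2)) ∧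
      (Q.2 - P.2) * ((σ Q).1 - (σ P).1) = (Q.1 - P.1) * ((σ Q).2 - (σ P).2)) ↔
    (∃ (r : Rˣ) (s t : R), ∀ x y : R, σ (x, y) = ((r : R) * x + s, (r : R) * y + t)) := by
  constructor
  · intro h
    have par₁ := (h (0, 0) (1, 0) (by simp)).2
    have par₂ := (h (0, 0) (0, 1) (by simp)).2
    have par₁₂ := (h (1, 0) (0, 1) (by simp)).2
    have apart₁ := (h (1, 0) (0, 0) (by simp)).1
    simp only [sub_zero, zero_sub, sub_self, zero_mul, one_mul] at par₁ par₂ par₁₂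
    have hr : IsUnit ((σ (1, 0)).1 - (σ (0, 0)).1) := by
      refine apart₁.resolve_right fun h' => ?_
      rw [← par₁] at h'
      exact not_isUnit_zero h'
    obtain ⟨r, hr⟩ := hr
    refine ⟨r, (σ (0, 0)).1, (σ (0, 0)).2, fun x y => ?_⟩
    have key := eq_mul_of_parallel_to_frame (r := (r : R)) (x := x) (y := y)
      (a := (σ (x, y)).1 - (σ (0, 0)).1) (b := (σ (x, y)).2 - (σ (0, 0)).2)
      (fun c => by
        have e := (h (x, y) (0, 0) (by simpa using c)).2
        dsimp only at e
        linear_combination e)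
      (fun c => by
        have e := (h (x, y) (1, 0) (by simpa using c)).2
        dsimp only at e
        linear_combination e - y * hr + (x - 1) * par₁)
      (fun c => by
        have e := (h (x, y) (0, 1) (by simpa using c)).2
        dsimp only at e
        linear_combination e + (y - 1) * par₂ - x * (par₁₂ - par₂ - hr - par₁))
    exact Prod.ext (by linear_combination key.1) (by linear_combination key.2)
  · rintro ⟨r, s, t, hσ⟩ ⟨p₀, p₁⟩ ⟨q₀, q₁⟩ hPQ
    simp only [hσ, add_sub_add_right_eq_sub, ← mul_sub, Units.isUnit_units_mul]
    exact ⟨hPQ, by ring⟩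
end
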